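/- Let T be a tree with capacities κ_j at level j, and suppose routing functions r_0,...,r_{d-1} are chosen independently with each r_j drawn from a pairwise independent family of functions L_{j+1} × {1,...,κ_{j+1}} → {1,...,κ_j}. Let ℓ be a 4d-accessible mismatch leaf (every node on its path to the root has load^κ < κ_level/(4d)). Then for each level j, conditioned on any choice of r_{j+1},...,r_{d-1}, the probability over r_j that some other mismatch leaf's trajectory merges with ℓ's trajectory at level j is at most 1/(4d); consequently the probability that ℓ fails to be the unique mismatch leaf mapped to its root bucket is at most 1/4. -/

import Mathlib

/-- The hierarchical load function on the tree `T(L^d)`. -/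
def hload {L : Type*} [Fintype L] (κ : ℕ → ℕ) (f : List L → ℕ) : ℕ → List L → ℕ
  | 0, v => f v
  | r + 1, v => min (κ v.length) (∑ a : L, hload κ f r (v ++ [a]))

/-- The index of the bucket on the trajectory of leaf `ℓ` at level `j`, induced by the
routing functions `r`. -/
def trajIdx {L : Type*} [Inhabited L] (r : ℕ → L → ℕ → ℕ) (d : ℕ) (ℓ : List L) (j : ℕ) : ℕ :=
  Nat.rec (motive := fun _ => ℕ) 0
    (fun k ih => r (d - 1 - k) (ℓ.getD (d - 1 - k) default) ih) (d - j)

/-- The routing-function family obtained by fixing the routing randomness `ρ` at every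
level except level `j`, where the randomness `ωj` is used instead. -/
def routeMix {L : Type*} (Ωf : ℕ → Type*) (d : ℕ) (R : ∀ m : ℕ, Ωf m → L → ℕ → ℕ)
    (ρ : ∀ m : Fin d, Ωf m) (j : ℕ) (ωj : Ωf j) : ℕ → L → ℕ → ℕ :=
  fun m a i =>
    if _hm : m = j then R j ωj a i
    else if hlt : m < d then R m (ρ ⟨m, hlt⟩) a i else 0

/-- The routing-function family determined by the full randomness `ρ`. -/
def routeAll {L : Type*} (Ωf : ℕ → Type*) (d : ℕ) (R : ∀ m : ℕ, Ωf m → L → ℕ → ℕ)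
    (ρ : ∀ m : Fin d, Ωf m) : ℕ → L → ℕ → ℕ :=
  fun m a i => if hlt : m < d then R m (ρ ⟨m, hlt⟩) a i else 0

section Trajectories

variable {L : Type*}

/-- The mismatch leaves of the depth-`d` tree that lie below the node `v`. -/
def mismatchBelow (d : ℕ) (M : List L → Prop) (v : List L) : Set (List L) :=
  {ℓ | ℓ.length = d ∧ M ℓ ∧ ℓ.take v.length = v}

theorem mismatchBelow_finite [Finite L] (d : ℕ) (M : List L → Prop) (v : List L) :
    (mismatchBelow d M v).Finite :=
  (List.finite_length_eq L d).subset fun _ h => h.1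

variable [Inhabited L]

/-- The indices of the buckets at the node `v` occupied by trajectories of mismatch leaves. -/
def occupied (r : ℕ → L → ℕ → ℕ) (d : ℕ) (M : List L → Prop) (v : List L) : Set ℕ :=
  (fun ℓ => trajIdx r d ℓ v.length) '' mismatchBelow d M v

/-- The buckets at the children of `v` occupied by trajectories of mismatch leaves. -/
def occupiedChildren (r : ℕ → L → ℕ → ℕ) (d : ℕ) (M : List L → Prop) (v : List L) :
    Set (L × ℕ) :=
  (fun ℓ => (ℓ.getD v.length default, trajIdx r d ℓ (v.length + 1))) '' mismatchBelow d M v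

theorem trajIdx_step (r : ℕ → L → ℕ → ℕ) {d j : ℕ} (ℓ : List L) (hj : j < d) :
    trajIdx r d ℓ j = r j (ℓ.getD j default) (trajIdx r d ℓ (j + 1)) := by
  unfold trajIdx
  have h1 : d - j = (d - (j + 1)) + 1 := by omega
  have h2 : d - 1 - (d - (j + 1)) = j := by omega
  rw [h1]
  simp only [h2]

theorem trajIdx_self (r : ℕ → L → ℕ → ℕ) (d : ℕ) (ℓ : List L) : trajIdx r d ℓ d = 0 := by
  simp [trajIdx]

theorem trajIdx_lt {r : ℕ → L → ℕ → ℕ} {d : ℕ} {κ : ℕ → ℕ}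
    (hr : ∀ m, m < d → ∀ a i, r m a i < κ m) (hκ : 0 < κ d) (ℓ : List L) {j : ℕ} (hj : j ≤ d) :
    trajIdx r d ℓ j < κ j := by
  rcases hj.lt_or_eq with h | rfl
  · rw [trajIdx_step r ℓ h]
    exact hr j h _ _
  · rwa [trajIdx_self]

theorem trajIdx_congr {r r' : ℕ → L → ℕ → ℕ} {d : ℕ} (ℓ : List L) {j : ℕ} (hj : j ≤ d)
    (h : ∀ m, j ≤ m → r m = r' m) : trajIdx r d ℓ j = trajIdx r' d ℓ j := by
  induction hj using Nat.decreasingInduction with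
  | self => simp only [trajIdx_self]
  | of_succ k hk ih =>
    rw [trajIdx_step r ℓ hk, trajIdx_step r' ℓ hk, h k le_rfl,
      ih fun m hm => h m (Nat.le_of_succ_le hm)]

theorem take_succ_eq_append_getD {j : ℕ} {ℓ : List L} (hj : j < ℓ.length) :
    ℓ.take (j + 1) = ℓ.take j ++ [ℓ.getD j default] := by
  rw [List.take_succ_eq_append_getElem hj, List.getD_eq_getElem _ _ hj]

theorem mem_mismatchBelow_child {d : ℕ} {M : List L → Prop} {v ℓ : List L} (hv : v.length < d)
    (hℓ : ℓ ∈ mismatchBelow d M v) :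
    ℓ ∈ mismatchBelow d M (v ++ [ℓ.getD v.length default]) := by
  obtain ⟨h1, h2, h3⟩ := hℓ
  refine ⟨h1, h2, ?_⟩
  rw [List.length_append, List.length_singleton, take_succ_eq_append_getD (h1 ▸ hv), h3]

theorem occupied_eq_image {r : ℕ → L → ℕ → ℕ} {d : ℕ} {M : List L → Prop} {v : List L}
    (hv : v.length < d) :
    occupied r d M v = (fun p => r v.length p.1 p.2) '' occupiedChildren r d M v := by
  rw [occupied, occupiedChildren, Set.image_image]
  exact Set.image_congr fun ℓ _ => trajIdx_step r ℓ hv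

variable [Fintype L]

theorem occupied_finite (r : ℕ → L → ℕ → ℕ) (d : ℕ) (M : List L → Prop) (v : List L) :
    (occupied r d M v).Finite :=
  (mismatchBelow_finite d M v).image _

theorem occupiedChildren_finite (r : ℕ → L → ℕ → ℕ) (d : ℕ) (M : List L → Prop) (v : List L) :
    (occupiedChildren r d M v).Finite :=
  (mismatchBelow_finite d M v).image _

theorem ncard_occupiedChildren_le (r : ℕ → L → ℕ → ℕ) {d : ℕ} (M : List L → Prop) {v : List L}
    (hv : v.length < d) :
    (occupiedChildren r d M v).ncard ≤ ∑ a : L, (occupied r d M (v ++ [a])).ncard := by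
  have hsub : occupiedChildren r d M v ⊆
      ⋃ a ∈ (Finset.univ : Finset L), Prod.mk a '' occupied r d M (v ++ [a]) := by
    rintro _ ⟨ℓ, hℓ, rfl⟩
    simp only [Set.mem_iUnion]
    refine ⟨ℓ.getD v.length default, Finset.mem_univ _, _,
      ⟨ℓ, mem_mismatchBelow_child hv hℓ, rfl⟩, ?_⟩
    simp
  refine (Set.ncard_le_ncard hsub ?_).trans
    ((Finset.set_ncard_biUnion_le _ _).trans (Finset.sum_le_sum fun a _ => ?_))
  · exact Set.Finite.biUnion (Finset.finite_toSet _) fun a _ => (occupied_finite r d M _).image _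
  · exact Set.ncard_image_le (occupied_finite r d M _)

/-- The load of a node bounds the number of its occupied buckets. -/
theorem ncard_occupied_le_hload {r : ℕ → L → ℕ → ℕ} {d : ℕ} {κ : ℕ → ℕ}
    (hr : ∀ m, m < d → ∀ a i, r m a i < κ m) (M : List L → Prop) [DecidablePred M]
    (k : ℕ) (v : List L) (hv : v.length + k = d) :
    (occupied r d M v).ncard ≤ hload κ (fun v => if M v then 1 else 0) k v := by
  induction k generalizing v with
  | zero =>
    have hleaf : ∀ ℓ ∈ mismatchBelow d M v, ℓ = v := by
      rintro ℓ ⟨h1, -, h3⟩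
      rwa [List.take_of_length_le (by omega)] at h3
    rw [hload]
    split_ifs with hM
    · refine (Set.ncard_le_one (occupied_finite r d M v)).2 ?_
      rintro _ ⟨ℓ, hℓ, rfl⟩ _ ⟨ℓ', hℓ', rfl⟩
      rw [hleaf ℓ hℓ, hleaf ℓ' hℓ']
    · rw [Nat.le_zero, Set.ncard_eq_zero (occupied_finite r d M v), occupied,
        Set.image_eq_empty]
      refine Set.eq_empty_of_forall_notMem fun ℓ hℓ => hM ?_
      rw [← hleaf ℓ hℓ]
      exact hℓ.2.1
  | succ k ih =>
    have hlt : v.length < d := by omega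
    rw [hload, le_min_iff]
    constructor
    · have hsub : occupied r d M v ⊆ ↑(Finset.range (κ v.length)) := by
        rw [occupied_eq_image hlt]
        rintro _ ⟨p, -, rfl⟩
        simpa using hr _ hlt p.1 p.2
      simpa [Set.ncard_coe_finset] using Set.ncard_le_ncard hsub (Finset.finite_toSet _)
    · rw [occupied_eq_image hlt]
      refine (Set.ncard_image_le (occupiedChildren_finite r d M v)).trans
        ((ncard_occupiedChildren_le r M hlt).trans (Finset.sum_le_sum fun a _ => ih _ ?_))
      simp only [List.length_append, List.length_singleton]
      omega

/-- Below an accessible node the capacity is not attained, so the load also bounds the number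
of occupied buckets at the children. -/
theorem ncard_occupiedChildren_le_hload {r : ℕ → L → ℕ → ℕ} {d : ℕ} {κ : ℕ → ℕ}
    (hr : ∀ m, m < d → ∀ a i, r m a i < κ m) (M : List L → Prop) [DecidablePred M]
    {v : List L} (hv : v.length < d)
    (hload_lt : hload κ (fun v => if M v then 1 else 0) (d - v.length) v < κ v.length) :
    (occupiedChildren r d M v).ncard ≤
      hload κ (fun v => if M v then 1 else 0) (d - v.length) v := by
  obtain ⟨k, hk⟩ : ∃ k, d - v.length = k + 1 := ⟨d - v.length - 1, by omega⟩
  rw [hk, hload] at hload_lt ⊢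
  rw [min_eq_right (by omega)]
  refine (ncard_occupiedChildren_le r M hv).trans
    (Finset.sum_le_sum fun a _ => ncard_occupied_le_hload hr M k _ ?_)
  simp only [List.length_append, List.length_singleton]
  omega

end Trajectories

/-- Two functions into `Fin k` with uniform joint distribution collide with probability `1/k`. -/
theorem ncard_collision_mul {Ω : Type*} [Fintype Ω] {k : ℕ} {f g : Ω → ℕ}
    (hk : 0 < k) (hf : ∀ ω, f ω < k)
    (h : ∀ b, b < k → {ω | f ω = b ∧ g ω = b}.ncard * k ^ 2 = Fintype.card Ω) :
    {ω | f ω = g ω}.ncard * k = Fintype.card Ω := by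
  classical
  have hsum : {ω | f ω = g ω}.ncard =
      ∑ b ∈ Finset.range k, {ω | f ω = b ∧ g ω = b}.ncard := by
    simp only [Set.ncard_eq_toFinset_card', Set.toFinset_ofPred]
    rw [Finset.card_eq_sum_card_fiberwise (f := f) (t := Finset.range k)
      fun ω _ => by simpa using hf ω]
    refine Finset.sum_congr rfl fun b _ => ?_
    rw [Finset.filter_filter]
    congr 1
    ext ω
    simp only [Finset.mem_filter]
    grind
  apply Nat.eq_of_mul_eq_mul_right hk
  rw [mul_assoc, ← sq, hsum, Finset.sum_mul,
    Finset.sum_congr rfl fun b hb => h b (Finset.mem_range.1 hb)]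
  simp [mul_comm]

/-- If an event `B ρ` about coordinate `j` does not depend on `ρ j` and always has conditional
probability at most `1/c`, then its probability is at most `1/c`. -/
theorem ncard_coordinate_event_mul_le {ι : Type*} [Fintype ι] [DecidableEq ι] {Ω : ι → Type*}
    [∀ i, Fintype (Ω i)] (j : ι) [Nonempty (Ω j)] (B : (∀ i, Ω i) → Set (Ω j)) (c : ℕ)
    (hB : ∀ ρ ω, B (Function.update ρ j ω) = B ρ)
    (hc : ∀ ρ, (B ρ).ncard * c ≤ Fintype.card (Ω j)) :
    {ρ | ρ j ∈ B ρ}.ncard * c ≤ Fintype.card (∀ i, Ω i) := by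
  classical
  have hswap : ∑ ρ : ∀ i, Ω i, (B ρ).ncard = {ρ | ρ j ∈ B ρ}.ncard * Fintype.card (Ω j) := by
    have h1 : ∀ ρ, (B ρ).ncard = ∑ ω : Ω j, if ω ∈ B ρ then 1 else 0 := fun ρ => by
      rw [Finset.sum_boole, Set.ncard_eq_toFinset_card']
      simp only [Nat.cast_id]
      congr 1
      ext ω
      simp
    have h2 : {ρ | ρ j ∈ B ρ}.ncard = ∑ ρ : ∀ i, Ω i, if ρ j ∈ B ρ then 1 else 0 := by
      rw [Finset.sum_boole, Set.ncard_eq_toFinset_card']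
      simp
    let swap : (∀ i, Ω i) × Ω j → (∀ i, Ω i) × Ω j := fun p => (Function.update p.1 j p.2, p.1 j)
    have hinv : Function.Involutive swap := fun p => by simp [swap]
    have h3 : ∑ p : (∀ i, Ω i) × Ω j, (if p.2 ∈ B p.1 then 1 else 0) =
        ∑ p : (∀ i, Ω i) × Ω j, if p.1 j ∈ B p.1 then 1 else 0 :=
      Fintype.sum_bijective swap hinv.bijective _ _ fun p => by simp [swap, hB]
    simp only [h1]
    rw [Fintype.sum_prod_type, Fintype.sum_prod_type] at h3
    rw [h3, h2, Finset.sum_mul]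
    refine Finset.sum_congr rfl fun ρ _ => ?_
    split_ifs <;> simp
  refine Nat.le_of_mul_le_mul_right ?_ (Fintype.card_pos (α := Ω j))
  calc {ρ | ρ j ∈ B ρ}.ncard * c * Fintype.card (Ω j)
      = ∑ ρ : ∀ i, Ω i, (B ρ).ncard * c := by rw [← Finset.sum_mul, hswap]; ring
    _ ≤ ∑ _ρ : ∀ i, Ω i, Fintype.card (Ω j) := Finset.sum_le_sum fun ρ _ => hc ρ
    _ = Fintype.card (∀ i, Ω i) * Fintype.card (Ω j) := by simp

section Routing

variable {L : Type*} {Ωf : ℕ → Type*} {d : ℕ} (R : ∀ m : ℕ, Ωf m → L → ℕ → ℕ)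

theorem routeMix_self (ρ : ∀ m : Fin d, Ωf m) (j : ℕ) (ω : Ωf j) :
    routeMix Ωf d R ρ j ω j = R j ω := by
  funext a i
  simp [routeMix]

theorem routeMix_congr_of_ne (ρ : ∀ m : Fin d, Ωf m) {j m : ℕ} (ω ω' : Ωf j) (hm : m ≠ j) :
    routeMix Ωf d R ρ j ω m = routeMix Ωf d R ρ j ω' m := by
  funext a i
  simp [routeMix, hm]

theorem routeMix_apply_coordinate (ρ : ∀ m : Fin d, Ωf m) (j : Fin d) :
    routeMix Ωf d R ρ j (ρ j) = routeAll Ωf d R ρ := by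
  funext m a i
  unfold routeMix routeAll
  split_ifs with h1 h2 h2
  · subst h1
    rfl
  · exact absurd (h1 ▸ j.2) h2
  · rfl
  · rfl

theorem routeMix_update (ρ : ∀ m : Fin d, Ωf m) (j : Fin d) (ω ω' : Ωf j) :
    routeMix Ωf d R (Function.update ρ j ω) j ω' = routeMix Ωf d R ρ j ω' := by
  funext m a i
  unfold routeMix
  split_ifs with h1 h2
  · rfl
  · rw [Function.update_of_ne]
    exact fun h => h1 (congrArg Fin.val h)
  · rfl

theorem routeMix_lt {κ : ℕ → ℕ}
    (hrange : ∀ m, m < d → ∀ (ω : Ωf m) (a : L) (i : ℕ), R m ω a i < κ m)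
    (ρ : ∀ m : Fin d, Ωf m) {j : ℕ} (ω : Ωf j) (m : ℕ) (hm : m < d) (a : L) (i : ℕ) :
    routeMix Ωf d R ρ j ω m a i < κ m := by
  unfold routeMix
  split_ifs with h1
  · subst h1
    exact hrange _ hm _ _ _
  · exact hrange _ hm _ _ _

variable [Inhabited L]

/-- The level-`j` randomness for which the trajectory of some other mismatch leaf merges with
that of `ℓ0` at level `j`. -/
def mergeEvent (M : List L → Prop) (ℓ0 : List L) (ρ : ∀ m : Fin d, Ωf m) (j : ℕ) : Set (Ωf j) :=
  {ωj : Ωf j | ∃ ℓ : List L, ℓ.length = d ∧ M ℓ ∧ ℓ ≠ ℓ0 ∧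
    (ℓ.take (j + 1), trajIdx (routeMix Ωf d R ρ j ωj) d ℓ (j + 1)) ≠
      (ℓ0.take (j + 1), trajIdx (routeMix Ωf d R ρ j ωj) d ℓ0 (j + 1)) ∧
    (ℓ.take j, trajIdx (routeMix Ωf d R ρ j ωj) d ℓ j) =
      (ℓ0.take j, trajIdx (routeMix Ωf d R ρ j ωj) d ℓ0 j)}

theorem ncard_mergeEvent_mul_le [Fintype L] [∀ m, Fintype (Ωf m)] [∀ m, Nonempty (Ωf m)]
    {κ : ℕ → ℕ}
    (hrange : ∀ m, m < d → ∀ (ω : Ωf m) (a : L) (i : ℕ), R m ω a i < κ m)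
    (hpair : ∀ m, m < d → ∀ (a a' : L) (i i' : ℕ), i < κ (m + 1) → i' < κ (m + 1) →
      (a, i) ≠ (a', i') → ∀ b b' : ℕ, b < κ m → b' < κ m →
      {ω : Ωf m | R m ω a i = b ∧ R m ω a' i' = b'}.ncard * (κ m) ^ 2 =
        Fintype.card (Ωf m))
    (M : List L → Prop) [DecidablePred M] {ℓ0 : List L} (hlen : ℓ0.length = d)
    (hκ : 0 < κ d) {j : ℕ} (hj : j < d)
    (hacc : 4 * d * hload κ (fun v => if M v then 1 else 0) (d - j) (ℓ0.take j) < κ j)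
    (ρ : ∀ m : Fin d, Ωf m) :
    (mergeEvent R M ℓ0 ρ j).ncard * (4 * d) ≤ Fintype.card (Ωf j) := by
  classical
  obtain ⟨ω₀⟩ := (inferInstance : Nonempty (Ωf j))
  set r := routeMix Ωf d R ρ j ω₀ with hr_def
  set v := ℓ0.take j with hv_def
  have hvlen : v.length = j := by simp [hv_def, hlen, hj.le]
  have hr : ∀ m, m < d → ∀ a i, r m a i < κ m := routeMix_lt R hrange ρ ω₀
  have hκj : 0 < κ j := (Nat.zero_le _).trans_lt hacc
  have htraj : ∀ ω ℓ, trajIdx (routeMix Ωf d R ρ j ω) d ℓ (j + 1) = trajIdx r d ℓ (j + 1) :=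
    fun ω ℓ => trajIdx_congr ℓ hj fun m hm => routeMix_congr_of_ne R ρ ω ω₀ (by omega)
  have hstep : ∀ ω ℓ, trajIdx (routeMix Ωf d R ρ j ω) d ℓ j =
      R j ω (ℓ.getD j default) (trajIdx r d ℓ (j + 1)) := fun ω ℓ => by
    rw [trajIdx_step _ ℓ hj, htraj, routeMix_self]
  let p0 : L × ℕ := (ℓ0.getD j default, trajIdx r d ℓ0 (j + 1))
  let P : Finset (L × ℕ) := (occupiedChildren_finite r d M v).toFinset.erase p0
  have hP : 4 * d * P.card ≤ κ j := by
    have h1 : P.card ≤ (occupiedChildren r d M v).ncard := by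
      rw [Set.ncard_eq_toFinset_card _ (occupiedChildren_finite r d M v)]
      exact Finset.card_erase_le
    have h2 := ncard_occupiedChildren_le_hload (v := v) hr M (by omega) (by
      rw [hvlen]
      exact (Nat.le_mul_of_pos_left _ (by omega)).trans_lt hacc)
    rw [hvlen] at h2
    exact (Nat.mul_le_mul_left _ (h1.trans h2)).trans hacc.le
  have hsub : mergeEvent R M ℓ0 ρ j ⊆
      ⋃ p ∈ P, {ω | R j ω p.1 p.2 = R j ω p0.1 p0.2} := by
    rintro ω ⟨ℓ, hl, hMl, -, hne, heq⟩
    rw [htraj ω ℓ, htraj ω ℓ0] at hne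
    rw [hstep ω ℓ, hstep ω ℓ0, Prod.mk.injEq] at heq
    simp only [Set.mem_iUnion]
    refine ⟨(ℓ.getD j default, trajIdx r d ℓ (j + 1)), ?_, heq.2⟩
    refine Finset.mem_erase.2 ⟨fun h => hne ?_, ?_⟩
    · obtain ⟨h1, h2⟩ := Prod.mk.inj h
      rw [take_succ_eq_append_getD (by omega), take_succ_eq_append_getD (by omega), heq.1, h1, h2]
    · rw [Set.Finite.mem_toFinset]
      refine ⟨ℓ, ⟨hl, hMl, ?_⟩, ?_⟩
      · rw [hvlen]
        exact heq.1
      · simp only [hvlen]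
  have hcoll : ∀ p ∈ P, {ω | R j ω p.1 p.2 = R j ω p0.1 p0.2}.ncard * κ j =
      Fintype.card (Ωf j) := by
    intro p hp
    obtain ⟨hne, hmem⟩ := Finset.mem_erase.1 hp
    rw [Set.Finite.mem_toFinset] at hmem
    obtain ⟨ℓ, -, rfl⟩ := hmem
    refine ncard_collision_mul hκj (fun ω => hrange j hj ω _ _) fun b hb => ?_
    refine hpair j hj _ _ _ _ ?_ ?_ hne b b hb hb
    · simp only [hvlen]
      exact trajIdx_lt hr hκ ℓ hj
    · exact trajIdx_lt hr hκ ℓ0 hj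
  have hcard : (mergeEvent R M ℓ0 ρ j).ncard * κ j ≤ P.card * Fintype.card (Ωf j) := by
    calc (mergeEvent R M ℓ0 ρ j).ncard * κ j
        ≤ (∑ p ∈ P, {ω | R j ω p.1 p.2 = R j ω p0.1 p0.2}.ncard) * κ j :=
          Nat.mul_le_mul_right _ ((Set.ncard_le_ncard hsub (Set.toFinite _)).trans
            (Finset.set_ncard_biUnion_le _ _))
      _ = P.card * Fintype.card (Ωf j) := by
          rw [Finset.sum_mul, Finset.sum_congr rfl hcoll, Finset.sum_const, smul_eq_mul]
  refine Nat.le_of_mul_le_mul_right ?_ hκj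
  calc (mergeEvent R M ℓ0 ρ j).ncard * (4 * d) * κ j
      = (mergeEvent R M ℓ0 ρ j).ncard * κ j * (4 * d) := by ring
    _ ≤ P.card * Fintype.card (Ωf j) * (4 * d) := Nat.mul_le_mul_right _ hcard
    _ = Fintype.card (Ωf j) * (4 * d * P.card) := by ring
    _ ≤ Fintype.card (Ωf j) * κ j := Nat.mul_le_mul_left _ hP

/-- Distinct leaves mapped to the same root bucket merge at some level. -/
theorem exists_merge_level (r : ℕ → L → ℕ → ℕ) {ℓ ℓ' : List L} (hl : ℓ.length = d)
    (hl' : ℓ'.length = d) (hne : ℓ ≠ ℓ') (h : trajIdx r d ℓ 0 = trajIdx r d ℓ' 0) :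
    ∃ j < d, (ℓ.take (j + 1), trajIdx r d ℓ (j + 1)) ≠ (ℓ'.take (j + 1), trajIdx r d ℓ' (j + 1)) ∧
      (ℓ.take j, trajIdx r d ℓ j) = (ℓ'.take j, trajIdx r d ℓ' j) := by
  by_contra! hcon
  have hall : ∀ j ≤ d, (ℓ.take j, trajIdx r d ℓ j) = (ℓ'.take j, trajIdx r d ℓ' j) := by
    intro j
    induction j with
    | zero => simp [h]
    | succ j ih =>
      intro hj
      by_contra hne'
      exact hcon j hj hne' (ih (by omega))
  have := congrArg Prod.fst (hall d le_rfl)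
  simp only at this
  rw [List.take_of_length_le hl.le, List.take_of_length_le hl'.le] at this
  exact hne this

end Routing

/-- Hierarchical mismatch recovery with pairwise independent routing functions.
Let `ℓ0` be a `4d`-accessible mismatch leaf (every node on its root path has
`load^κ < κ_level/(4d)`).  Then (1) for each level `j < d` and each fixed choice of the
routing randomness at the other levels, the probability over the level-`j` randomness
that some other mismatch leaf's trajectory merges with `ℓ0`'s trajectory at level `j`
(different buckets at level `j+1`, same bucket at level `j`) is at most `1/(4d)`; and
(2) the probability over all the routing randomness that `ℓ0` fails to be the unique
mismatch leaf mapped to its root bucket is at most `1/4`. -/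
theorem accessible_leaf_recoverable {L : Type*} [Fintype L] [Inhabited L] [DecidableEq L]
    (d : ℕ) (hd : 0 < d) (κ : ℕ → ℕ)
    (Ωf : ℕ → Type*) [∀ m, Fintype (Ωf m)] [∀ m, Nonempty (Ωf m)]
    (R : ∀ m : ℕ, Ωf m → L → ℕ → ℕ)
    (hrange : ∀ m, m < d → ∀ (ω : Ωf m) (a : L) (i : ℕ), R m ω a i < κ m)
    (hpair : ∀ m, m < d → ∀ (a a' : L) (i i' : ℕ), i < κ (m + 1) → i' < κ (m + 1) →
      (a, i) ≠ (a', i') → ∀ b b' : ℕ, b < κ m → b' < κ m →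
      {ω : Ωf m | R m ω a i = b ∧ R m ω a' i' = b'}.ncard * (κ m) ^ 2 =
        Fintype.card (Ωf m))
    (M : List L → Prop) [DecidablePred M]
    (ℓ0 : List L) (hlen : ℓ0.length = d) (hM : M ℓ0)
    (hacc : ∀ j, j ≤ d →
      4 * d * hload κ (fun v => if M v then 1 else 0) (d - j) (ℓ0.take j) < κ j) :
    (∀ j, j < d → ∀ ρ : ∀ m : Fin d, Ωf m,
      {ωj : Ωf j | ∃ ℓ : List L, ℓ.length = d ∧ M ℓ ∧ ℓ ≠ ℓ0 ∧
          (ℓ.take (j + 1), trajIdx (routeMix Ωf d R ρ j ωj) d ℓ (j + 1)) ≠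
            (ℓ0.take (j + 1), trajIdx (routeMix Ωf d R ρ j ωj) d ℓ0 (j + 1)) ∧
          (ℓ.take j, trajIdx (routeMix Ωf d R ρ j ωj) d ℓ j) =
            (ℓ0.take j, trajIdx (routeMix Ωf d R ρ j ωj) d ℓ0 j)}.ncard * (4 * d) ≤
        Fintype.card (Ωf j)) ∧
    ({ρ : ∀ m : Fin d, Ωf m | ∃ ℓ : List L, ℓ.length = d ∧ M ℓ ∧ ℓ ≠ ℓ0 ∧
        trajIdx (routeAll Ωf d R ρ) d ℓ 0 = trajIdx (routeAll Ωf d R ρ) d ℓ0 0}.ncard * 4 ≤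
      Fintype.card (∀ m : Fin d, Ωf m)) := by
  classical
  have hκ : 0 < κ d := (Nat.zero_le _).trans_lt (hacc d le_rfl)
  have hlevel : ∀ j, j < d → ∀ ρ : ∀ m : Fin d, Ωf m,
      (mergeEvent R M ℓ0 ρ j).ncard * (4 * d) ≤ Fintype.card (Ωf j) := fun j hj ρ =>
    ncard_mergeEvent_mul_le R hrange hpair M hlen hκ hj (hacc j hj.le) ρ
  refine ⟨hlevel, ?_⟩
  set F : Set (∀ m : Fin d, Ωf m) := {ρ | ∃ ℓ : List L, ℓ.length = d ∧ M ℓ ∧ ℓ ≠ ℓ0 ∧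
    trajIdx (routeAll Ωf d R ρ) d ℓ 0 = trajIdx (routeAll Ωf d R ρ) d ℓ0 0}
  have hsub : F ⊆ ⋃ j ∈ (Finset.univ : Finset (Fin d)),
      {ρ : ∀ m : Fin d, Ωf m | ρ j ∈ mergeEvent R M ℓ0 ρ j} := by
    rintro ρ ⟨ℓ, hl, hMl, hne, heq⟩
    obtain ⟨j, hj, hmerge⟩ := exists_merge_level _ hl hlen hne heq
    simp only [Set.mem_iUnion]
    refine ⟨⟨j, hj⟩, Finset.mem_univ _, ℓ, hl, hMl, hne, ?_⟩
    rw [routeMix_apply_coordinate R ρ ⟨j, hj⟩]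
    exact hmerge
  have hcoord : ∀ j : Fin d, {ρ : ∀ m : Fin d, Ωf m | ρ j ∈ mergeEvent R M ℓ0 ρ j}.ncard *
      (4 * d) ≤ Fintype.card (∀ m : Fin d, Ωf m) := fun j =>
    ncard_coordinate_event_mul_le j (fun ρ => mergeEvent R M ℓ0 ρ j) (4 * d)
      (fun ρ ω => by simp only [mergeEvent, routeMix_update]) fun ρ => hlevel j j.2 ρ
  refine Nat.le_of_mul_le_mul_right ?_ hd
  calc F.ncard * 4 * d = F.ncard * (4 * d) := by ring
    _ ≤ (∑ j : Fin d, {ρ : ∀ m : Fin d, Ωf m | ρ j ∈ mergeEvent R M ℓ0 ρ j}.ncard) * (4 * d) :=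
        Nat.mul_le_mul_right _ ((Set.ncard_le_ncard hsub (Set.toFinite _)).trans
          (Finset.set_ncard_biUnion_le _ _))
    _ ≤ ∑ _j : Fin d, Fintype.card (∀ m : Fin d, Ωf m) := by
        rw [Finset.sum_mul]
        exact Finset.sum_le_sum fun j _ => hcoord j
    _ = Fintype.card (∀ m : Fin d, Ωf m) * d := by
        rw [Finset.sum_const, Finset.card_univ, Fintype.card_fin, smul_eq_mul, mul_comm]
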